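/- arXiv:2505.00457 — 2 statements merged into one kernel-verified Lean document; each statement's English description precedes it below -/
import Mathlib

section
/- Let ρ₀ and ρ₁ be density matrices on ℂ^N and let α ≥ 1 be real. Define the N²×N² density matrices ρ'₀ := (1/2)·(ρ₀ ⊗ ρ₀ + ρ₁ ⊗ ρ₁) and ρ'₁ := (1/2)·(ρ₀ ⊗ ρ₁ + ρ₁ ⊗ ρ₀), where ⊗ denotes the Kronecker product. Then T_α(ρ'₀, ρ'₁) = (T_α(ρ₀, ρ₁))². -/
open Matrix
open scoped ComplexOrder
open scoped Kronecker

/-- The quantum ℓ_α distance `T_α(ρ₀,ρ₁) = (1/2)·(tr(|ρ₀−ρ₁|^α))^(1/α)`. -/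
noncomputable def lpDist {n : Type*} [Fintype n] [DecidableEq n]
    (α : ℝ) (ρ₀ ρ₁ : Matrix n n ℂ) : ℝ :=
  2⁻¹ * ((cfc (fun x : ℝ => |x| ^ α) (ρ₀ - ρ₁)).trace.re) ^ (1 / α)

namespace Matrix

variable {n m : Type*} [Fintype n] [DecidableEq n] [Fintype m] [DecidableEq m]

/-- The trace of `f(A)` is the sum of `f` over the diagonal of any unitary diagonalization
of `A`. -/
lemma trace_cfc_of_eq_conj_diagonal (f : ℝ → ℝ) {A U : Matrix n n ℂ}
    (hU : U ∈ unitary (Matrix n n ℂ)) {d : n → ℝ}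
    (hAd : A = U * diagonal (fun i => (d i : ℂ)) * star U) :
    (cfc f A).trace = ((∑ i, f (d i) : ℝ) : ℂ) := by
  have hA : A.IsHermitian := by
    rw [hAd, star_eq_conjTranspose]
    refine isHermitian_mul_mul_conjTranspose _ (isHermitian_diagonal_iff.mpr fun i => ?_)
    simp [isSelfAdjoint_iff]
  have hchar : A.charpoly = ∏ i, (Polynomial.X - Polynomial.C (d i : ℂ)) := by
    rw [hAd, charpoly_mul_comm, ← mul_assoc, Unitary.star_mul_self_of_mem hU, one_mul,
      charpoly_diagonal]
  have hroots : Finset.univ.val.map hA.eigenvalues = Finset.univ.val.map d := by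
    apply Multiset.map_injective Complex.ofReal_injective
    rw [Multiset.map_map, Multiset.map_map]
    refine hA.roots_charpoly_eq_eigenvalues.symm.trans ?_
    rw [hchar, Polynomial.roots_prod _ _
      (Finset.prod_ne_zero_iff.mpr fun i _ => Polynomial.X_sub_C_ne_zero _)]
    simp
  have hsum : ∑ i, f (hA.eigenvalues i) = ∑ i, f (d i) := by
    have h := congrArg (fun s => (s.map f).sum) hroots
    rwa [Multiset.map_map, Multiset.map_map] at h
  rw [hA.cfc_eq, IsHermitian.cfc, Unitary.conjStarAlgAut_apply, trace_mul_comm, ← mul_assoc,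
    Unitary.coe_star_mul_self, one_mul, trace_diagonal, ← hsum]
  simp

lemma IsHermitian.trace_cfc {A : Matrix n n ℂ} (hA : A.IsHermitian) (f : ℝ → ℝ) :
    (cfc f A).trace = ((∑ i, f (hA.eigenvalues i) : ℝ) : ℂ) :=
  trace_cfc_of_eq_conj_diagonal f hA.eigenvectorUnitary.2 hA.spectral_theorem

lemma IsHermitian.trace_cfc_smul_kronecker {A : Matrix n n ℂ} {B : Matrix m m ℂ}
    (hA : A.IsHermitian) (hB : B.IsHermitian) (c : ℝ) (f : ℝ → ℝ) :
    (cfc f ((c : ℂ) • (A ⊗ₖ B))).trace =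
      ((∑ p : n × m, f (c * (hA.eigenvalues p.1 * hB.eigenvalues p.2)) : ℝ) : ℂ) := by
  refine trace_cfc_of_eq_conj_diagonal f
    (kronecker_mem_unitary hA.eigenvectorUnitary.2 hB.eigenvectorUnitary.2) ?_
  have hdiag : diagonal (fun p : n × m =>
      ((c * (hA.eigenvalues p.1 * hB.eigenvalues p.2) : ℝ) : ℂ)) =
      (c : ℂ) • (diagonal (RCLike.ofReal ∘ hA.eigenvalues) ⊗ₖ
        diagonal (RCLike.ofReal ∘ hB.eigenvalues)) := by
    rw [diagonal_kronecker_diagonal, ← diagonal_smul]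
    congr 1
    ext p
    simp
  rw [hdiag, Matrix.mul_smul, Matrix.smul_mul, star_eq_conjTranspose, conjTranspose_kronecker,
    ← mul_kronecker_mul, ← mul_kronecker_mul]
  congr 2
  · exact hA.spectral_theorem
  · exact hB.spectral_theorem

end Matrix

theorem lpDist_xor_sq {N : ℕ} (hN : 0 < N)
    (ρ₀ ρ₁ : Matrix (Fin N) (Fin N) ℂ)
    (h₀ : ρ₀.PosSemidef) (ht₀ : ρ₀.trace = 1)
    (h₁ : ρ₁.PosSemidef) (ht₁ : ρ₁.trace = 1)
    (α : ℝ) (hα : 1 ≤ α) :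
    lpDist α ((2 : ℂ)⁻¹ • (ρ₀ ⊗ₖ ρ₀ + ρ₁ ⊗ₖ ρ₁))
        ((2 : ℂ)⁻¹ • (ρ₀ ⊗ₖ ρ₁ + ρ₁ ⊗ₖ ρ₀)) =
      (lpDist α ρ₀ ρ₁) ^ 2 := by
  have hD : (ρ₀ - ρ₁).IsHermitian := h₀.isHermitian.sub h₁.isHermitian
  have hdiff : (2 : ℂ)⁻¹ • (ρ₀ ⊗ₖ ρ₀ + ρ₁ ⊗ₖ ρ₁) - (2 : ℂ)⁻¹ • (ρ₀ ⊗ₖ ρ₁ + ρ₁ ⊗ₖ ρ₀) =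
      ((2⁻¹ : ℝ) : ℂ) • ((ρ₀ - ρ₁) ⊗ₖ (ρ₀ - ρ₁)) := by
    ext ⟨i, j⟩ ⟨k, l⟩
    simp [kroneckerMap_apply]
    ring
  have hsum : ∑ p : Fin N × Fin N, |2⁻¹ * (hD.eigenvalues p.1 * hD.eigenvalues p.2)| ^ α =
      2⁻¹ ^ α * ((∑ i, |hD.eigenvalues i| ^ α) * ∑ i, |hD.eigenvalues i| ^ α) := by
    rw [Fintype.sum_mul_sum, ← Fintype.sum_prod_type', Finset.mul_sum]
    refine Finset.sum_congr rfl fun p _ => ?_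
    rw [abs_mul, abs_mul, Real.mul_rpow (abs_nonneg _) (by positivity),
      Real.mul_rpow (abs_nonneg _) (abs_nonneg _), abs_of_pos (by norm_num : (0 : ℝ) < 2⁻¹)]
  have hS : 0 ≤ ∑ i, |hD.eigenvalues i| ^ α := by positivity
  rw [lpDist, lpDist, hdiff, hD.trace_cfc_smul_kronecker hD, hD.trace_cfc, Complex.ofReal_re,
    Complex.ofReal_re, hsum, Real.mul_rpow (by positivity) (by positivity), Real.mul_rpow hS hS,
    ← Real.rpow_mul (by norm_num), mul_one_div_cancel (by linarith), Real.rpow_one]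
  ring
end

section
/- Let ρ₀ and ρ₁ be density matrices on ℂ^N and let α ≥ 1 be real. Then T_α(ρ₀ ⊗ ρ₀, ρ₁ ⊗ ρ₁) ≤ 2 · T_α(ρ₀, ρ₁), where ⊗ denotes the Kronecker product. -/
open Matrix
open scoped ComplexOrder
open scoped Kronecker

namespace Matrix

variable {m n : Type*} [Fintype m] [DecidableEq m] [Fintype n] [DecidableEq n]

lemma sum_normSq_row_of_mem_unitaryGroup {V : Matrix n n ℂ} (hV : V ∈ unitaryGroup n ℂ) (i : n) :
    ∑ j, Complex.normSq (V i j) = 1 := by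
  have h := congrFun₂ (mem_unitaryGroup_iff.mp hV) i i
  rw [mul_apply, one_apply_eq] at h
  simp only [star_apply, RCLike.star_def, Complex.mul_conj] at h
  exact_mod_cast h

lemma sum_normSq_col_of_mem_unitaryGroup {V : Matrix n n ℂ} (hV : V ∈ unitaryGroup n ℂ) (j : n) :
    ∑ i, Complex.normSq (V i j) = 1 := by
  simpa using sum_normSq_row_of_mem_unitaryGroup (Unitary.star_mem hV) j

lemma re_conj_diagonal_apply_self (V : Matrix n n ℂ) (d : n → ℝ) (i : n) :
    ((V * diagonal (fun j => (d j : ℂ)) * star V) i i).re =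
      ∑ j, Complex.normSq (V i j) * d j := by
  rw [mul_apply]
  simp only [mul_diagonal, star_apply, RCLike.star_def, Complex.re_sum]
  refine Finset.sum_congr rfl fun j _ => ?_
  rw [mul_right_comm, Complex.mul_conj, ← Complex.ofReal_mul, Complex.ofReal_re]

/-- A Peierls-type inequality: in any orthonormal basis, the `α`-th power sum of the diagonal of a
Hermitian matrix is at most the `α`-th power sum of its eigenvalues. -/
lemma sum_abs_re_conj_diagonal_rpow_le {V : Matrix n n ℂ} (hV : V ∈ unitaryGroup n ℂ)
    (d : n → ℝ) {α : ℝ} (hα : 1 ≤ α) :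
    ∑ i, |((V * diagonal (fun j => (d j : ℂ)) * star V) i i).re| ^ α ≤ ∑ j, |d j| ^ α := by
  calc ∑ i, |((V * diagonal (fun j => (d j : ℂ)) * star V) i i).re| ^ α
      ≤ ∑ i, ∑ j, Complex.normSq (V i j) * |d j| ^ α := by
        refine Finset.sum_le_sum fun i _ => ?_
        rw [re_conj_diagonal_apply_self]
        calc |∑ j, Complex.normSq (V i j) * d j| ^ α
            ≤ (∑ j, Complex.normSq (V i j) * |d j|) ^ α := by
              refine Real.rpow_le_rpow (abs_nonneg _) ?_ (zero_le_one.trans hα)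
              refine (Finset.abs_sum_le_sum_abs _ _).trans_eq (Finset.sum_congr rfl fun j _ => ?_)
              rw [abs_mul, abs_of_nonneg (Complex.normSq_nonneg _)]
          _ ≤ _ := Real.rpow_arith_mean_le_arith_mean_rpow _ _ _
              (fun _ _ => Complex.normSq_nonneg _) (sum_normSq_row_of_mem_unitaryGroup hV i)
              (fun _ _ => abs_nonneg _) hα
    _ = ∑ j, |d j| ^ α := by
        rw [Finset.sum_comm]
        simp_rw [← Finset.sum_mul, sum_normSq_col_of_mem_unitaryGroup hV, one_mul]

namespace IsHermitian

lemma eq_conj_diagonal_eigenvalues {A : Matrix n n ℂ} (hA : A.IsHermitian) :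
    A = (hA.eigenvectorUnitary : Matrix n n ℂ) * diagonal (fun i => (hA.eigenvalues i : ℂ)) *
      star (hA.eigenvectorUnitary : Matrix n n ℂ) := by
  conv_lhs => rw [hA.spectral_theorem, Unitary.conjStarAlgAut_apply]
  rfl

lemma trace_cfc_re {A : Matrix n n ℂ} (hA : A.IsHermitian) (f : ℝ → ℝ) :
    (cfc f A).trace.re = ∑ i, f (hA.eigenvalues i) := by
  rw [hA.cfc_eq, IsHermitian.cfc, Unitary.conjStarAlgAut_apply, trace_mul_comm, ← mul_assoc]
  simp [trace_diagonal]

lemma star_eigenvectorUnitary_mul_self_mul {A : Matrix n n ℂ} (hA : A.IsHermitian) :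
    star (hA.eigenvectorUnitary : Matrix n n ℂ) * A * (hA.eigenvectorUnitary : Matrix n n ℂ) =
      diagonal (fun i => (hA.eigenvalues i : ℂ)) := by
  have h := hA.conjStarAlgAut_star_eigenvectorUnitary
  rwa [Unitary.conjStarAlgAut_star_apply] at h

/-- The triangle inequality for the Schatten `α`-norm, with the summands given in diagonalized
form. -/
lemma schatten_add_le {X W V : Matrix n n ℂ} {a b : n → ℝ} (hX : X.IsHermitian)
    (hW : W ∈ unitaryGroup n ℂ) (hV : V ∈ unitaryGroup n ℂ)
    (h : X = W * diagonal (fun i => (a i : ℂ)) * star W +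
      V * diagonal (fun i => (b i : ℂ)) * star V) {α : ℝ} (hα : 1 ≤ α) :
    (∑ i, |hX.eigenvalues i| ^ α) ^ (1 / α) ≤
      (∑ i, |a i| ^ α) ^ (1 / α) + (∑ i, |b i| ^ α) ^ (1 / α) := by
  have hU : star (hX.eigenvectorUnitary : Matrix n n ℂ) ∈ unitaryGroup n ℂ :=
    Unitary.star_mem hX.eigenvectorUnitary.2
  set U : Matrix n n ℂ := (hX.eigenvectorUnitary : Matrix n n ℂ) with hU_def
  have key : diagonal (fun i => (hX.eigenvalues i : ℂ)) =
      (star U * W) * diagonal (fun i => (a i : ℂ)) * star (star U * W) +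
      (star U * V) * diagonal (fun i => (b i : ℂ)) * star (star U * V) := by
    rw [← hX.star_eigenvectorUnitary_mul_self_mul, ← hU_def]
    conv_lhs => rw [h]
    simp only [star_mul, star_star, mul_add, add_mul, mul_assoc]
  have hdiag (i : n) : hX.eigenvalues i =
      (((star U * W) * diagonal (fun i => (a i : ℂ)) * star (star U * W)) i i).re +
      (((star U * V) * diagonal (fun i => (b i : ℂ)) * star (star U * V)) i i).re := by
    have := congrArg Complex.re (congrFun₂ key i i)
    rwa [diagonal_apply_eq, Complex.ofReal_re, add_apply, Complex.add_re] at this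
  have hα' : 0 ≤ 1 / α := by positivity
  simp_rw [hdiag]
  refine (Real.Lp_add_le _ _ _ hα).trans (add_le_add ?_ ?_)
  · exact Real.rpow_le_rpow (by positivity)
      (sum_abs_re_conj_diagonal_rpow_le (mul_mem hU hW) a hα) hα'
  · exact Real.rpow_le_rpow (by positivity)
      (sum_abs_re_conj_diagonal_rpow_le (mul_mem hU hV) b hα) hα'

lemma kronecker_eq_conj_diagonal {A : Matrix m m ℂ} {B : Matrix n n ℂ}
    (hA : A.IsHermitian) (hB : B.IsHermitian) :
    A ⊗ₖ B = ((hA.eigenvectorUnitary : Matrix m m ℂ) ⊗ₖ (hB.eigenvectorUnitary : Matrix n n ℂ)) *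
      diagonal (fun i : m × n => ((hA.eigenvalues i.1 * hB.eigenvalues i.2 : ℝ) : ℂ)) *
      star ((hA.eigenvectorUnitary : Matrix m m ℂ) ⊗ₖ
        (hB.eigenvectorUnitary : Matrix n n ℂ)) := by
  conv_lhs => rw [hA.eq_conj_diagonal_eigenvalues, hB.eq_conj_diagonal_eigenvalues]
  simp only [mul_kronecker_mul, star_eq_conjTranspose, conjTranspose_kronecker,
    diagonal_kronecker_diagonal, Complex.ofReal_mul]

end IsHermitian

lemma PosSemidef.sum_abs_eigenvalues_rpow_le_one {A : Matrix n n ℂ} (hA : A.PosSemidef)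
    (ht : A.trace = 1) {α : ℝ} (hα : 1 ≤ α) :
    ∑ i, |hA.isHermitian.eigenvalues i| ^ α ≤ 1 := by
  have hsum : ∑ i, hA.isHermitian.eigenvalues i = 1 := by
    have h := hA.isHermitian.trace_eq_sum_eigenvalues
    rw [ht] at h
    simpa using (congrArg Complex.re h).symm
  have hnonneg := hA.eigenvalues_nonneg
  rw [← hsum]
  refine Finset.sum_le_sum fun i _ => ?_
  rw [abs_of_nonneg (hnonneg i)]
  have hle : hA.isHermitian.eigenvalues i ≤ 1 :=
    hsum ▸ Finset.single_le_sum (fun j _ => hnonneg j) (Finset.mem_univ i)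
  exact Real.rpow_le_self_of_le_one (hnonneg i) hle hα

end Matrix

theorem lpDist_kron_le_two_mul {N : ℕ} (hN : 0 < N)
    (ρ₀ ρ₁ : Matrix (Fin N) (Fin N) ℂ)
    (h₀ : ρ₀.PosSemidef) (ht₀ : ρ₀.trace = 1)
    (h₁ : ρ₁.PosSemidef) (ht₁ : ρ₁.trace = 1)
    (α : ℝ) (hα : 1 ≤ α) :
    lpDist α (ρ₀ ⊗ₖ ρ₀) (ρ₁ ⊗ₖ ρ₁) ≤ 2 * lpDist α ρ₀ ρ₁ := by
  have hD : (ρ₀ - ρ₁).IsHermitian := h₀.isHermitian.sub h₁.isHermitian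
  have hX : (ρ₀ ⊗ₖ ρ₀ - ρ₁ ⊗ₖ ρ₁).IsHermitian := by
    simp only [IsHermitian, conjTranspose_sub, conjTranspose_kronecker,
      h₀.isHermitian.eq, h₁.isHermitian.eq]
  have hsplit : ρ₀ ⊗ₖ ρ₀ - ρ₁ ⊗ₖ ρ₁ = ρ₀ ⊗ₖ (ρ₀ - ρ₁) + (ρ₀ - ρ₁) ⊗ₖ ρ₁ := by
    ext i j
    simp only [Matrix.sub_apply, Matrix.add_apply, kroneckerMap_apply]
    ring
  have hS : 0 ≤ ∑ i, |hD.eigenvalues i| ^ α := by positivity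
  have hα' : 0 ≤ 1 / α := by positivity
  rw [hD.kronecker_eq_conj_diagonal h₁.isHermitian,
    h₀.isHermitian.kronecker_eq_conj_diagonal hD] at hsplit
  have htri := hX.schatten_add_le
    (kronecker_mem_unitary h₀.isHermitian.eigenvectorUnitary.2 hD.eigenvectorUnitary.2)
    (kronecker_mem_unitary hD.eigenvectorUnitary.2 h₁.isHermitian.eigenvectorUnitary.2)
    hsplit hα
  simp only [abs_mul, Real.mul_rpow (abs_nonneg _) (abs_nonneg _), Fintype.sum_prod_type,
    ← Finset.sum_mul_sum] at htri
  have hleft := Real.rpow_le_rpow (by positivity)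
    (mul_le_of_le_one_left hS (h₀.sum_abs_eigenvalues_rpow_le_one ht₀ hα)) hα'
  have hright := Real.rpow_le_rpow (by positivity)
    (mul_le_of_le_one_right hS (h₁.sum_abs_eigenvalues_rpow_le_one ht₁ hα)) hα'
  rw [lpDist, lpDist, hX.trace_cfc_re, hD.trace_cfc_re, Fintype.sum_prod_type]
  linarith
end
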